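/- There exist a constant M > 0 and a sequence (f_n) of continuous real-valued functions on [0,1] such that for every n ∈ ℕ and all real numbers λ_1, …, λ_n, one has (1/M) · ‖(λ_1, …, λ_n, 0, …)‖_J ≤ ‖λ_1 f_1 + ⋯ + λ_n f_n‖_∞ ≤ M · ‖(λ_1, …, λ_n, 0, …)‖_J, where ‖·‖_∞ is the supremum norm on C[0,1]. -/

import Mathlib

open unitInterval

/-- The James norm of a sequence `x = (x₀, x₁, x₂, …)` of real numbers (the sequence is
indexed starting at `0`, corresponding to the paper's `x₁, x₂, …`):
`‖x‖_J = sup { √(x_{p 0}² + (x_{p 1} − x_{p 0})² + ⋯ + (x_{p k} − x_{p (k−1)})²) :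
  k ∈ ℕ, p : ℕ → ℕ strictly increasing }`. -/
noncomputable def jamesNorm (x : ℕ → ℝ) : ℝ :=
  sSup {r : ℝ | ∃ (k : ℕ) (p : ℕ → ℕ), StrictMono p ∧
    r = Real.sqrt ((x (p 0)) ^ 2 + ∑ i ∈ Finset.range k, (x (p (i + 1)) - x (p i)) ^ 2)}

/-- Every nonempty compact set of real sequences is contained in a path. -/
theorem IsCompact.exists_path_range_superset {K : Set (ℕ → ℝ)} (hK : IsCompact K)
    (hne : K.Nonempty) : ∃ φ : C(I, ℕ → ℝ), K ⊆ Set.range φ := by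
  have : Nonempty K := hne.to_subtype
  have : CompactSpace K := isCompact_iff_compactSpace.mp hK
  let : MetricSpace K := TopologicalSpace.metrizableSpaceMetric K
  obtain ⟨h, hcont, hsurj⟩ := exists_nat_bool_continuous_surjective_of_compact K
  let e : (ℕ → Bool) → I := fun b ↦
    ⟨cantorSetHomeomorphNatToBool.symm b,
      cantorSet_subset_unitInterval (cantorSetHomeomorphNatToBool.symm b).2⟩
  have he : Continuous e := by fun_prop
  have hinj : Function.Injective e := fun a b hab ↦
    cantorSetHomeomorphNatToBool.symm.injective (Subtype.ext (congrArg (fun t : I ↦ (t : ℝ)) hab))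
  obtain ⟨φ, hφ⟩ := ContinuousMap.exists_extension' (he.isClosedEmbedding hinj)
    (⟨fun b ↦ (h b : ℕ → ℝ), by fun_prop⟩ : C(ℕ → Bool, ℕ → ℝ))
  refine ⟨φ, fun y hy ↦ ?_⟩
  obtain ⟨b, hb⟩ := hsurj ⟨y, hy⟩
  refine ⟨e b, (congrFun hφ b).trans ?_⟩
  simp [hb]

/-- The truncation of a sequence to its first `n` terms. -/
def truncate (n : ℕ) (x : ℕ → ℝ) : ℕ → ℝ := fun j ↦ if j < n then x j else 0

theorem truncate_truncate (m n : ℕ) (x : ℕ → ℝ) :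
    truncate m (truncate n x) = truncate (min m n) x := by
  ext j
  simp only [truncate, lt_min_iff]
  split_ifs <;> simp_all

theorem truncate_smul (n : ℕ) (c : ℝ) (x : ℕ → ℝ) : truncate n (c • x) = c • truncate n x := by
  ext j
  simp [truncate]

theorem map_truncate (L : (ℕ → ℝ) →ₗ[ℝ] ℝ) (n : ℕ) (x : ℕ → ℝ) :
    L (truncate n x) = ∑ j ∈ Finset.range n, L (Pi.single j 1) * x j := by
  have h : truncate n x = ∑ j ∈ Finset.range n, x j • (Pi.single j 1 : ℕ → ℝ) := by
    ext i
    simp [truncate, Finset.sum_apply, Pi.single_apply]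
  simp [h, mul_comm]

/-- The sum of squares along `p 0, …, p k` whose supremum is the squared James norm. -/
def jamesEnergy (x : ℕ → ℝ) (k : ℕ) (p : ℕ → ℕ) : ℝ :=
  x (p 0) ^ 2 + ∑ i ∈ Finset.range k, (x (p (i + 1)) - x (p i)) ^ 2

theorem jamesEnergy_nonneg (x : ℕ → ℝ) (k : ℕ) (p : ℕ → ℕ) : 0 ≤ jamesEnergy x k p := by
  unfold jamesEnergy
  positivity

theorem jamesEnergy_smul (c : ℝ) (x : ℕ → ℝ) (k : ℕ) (p : ℕ → ℕ) :
    jamesEnergy (c • x) k p = c ^ 2 * jamesEnergy x k p := by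
  simp only [jamesEnergy, Pi.smul_apply, smul_eq_mul, mul_add, Finset.mul_sum]
  congr 1
  · ring
  · exact Finset.sum_congr rfl fun i _ ↦ by ring

theorem jamesEnergy_le_sum_sq (x : ℕ → ℝ) (k : ℕ) (p : ℕ → ℕ) :
    jamesEnergy x k p ≤ 4 * ∑ i ∈ Finset.range (k + 1), x (p i) ^ 2 := by
  suffices h : jamesEnergy x k p + 2 * x (p k) ^ 2 ≤
      4 * ∑ i ∈ Finset.range (k + 1), x (p i) ^ 2 by nlinarith [sq_nonneg (x (p k))]
  induction k with
  | zero => simp [jamesEnergy]; nlinarith [sq_nonneg (x (p 0))]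
  | succ k ih =>
    rw [Finset.sum_range_succ]
    simp only [jamesEnergy, Finset.sum_range_succ _ k] at ih ⊢
    nlinarith [sq_nonneg (x (p (k + 1)) + x (p k))]

theorem jamesEnergy_truncate_le_sum_sq (x : ℕ → ℝ) (n k : ℕ) {p : ℕ → ℕ} (hp : StrictMono p) :
    jamesEnergy (truncate n x) k p ≤ 4 * ∑ j ∈ Finset.range n, x j ^ 2 := by
  refine (jamesEnergy_le_sum_sq _ k p).trans (mul_le_mul_of_nonneg_left ?_ (by norm_num))
  rw [← Finset.sum_image (f := fun j ↦ truncate n x j ^ 2) hp.injective.injOn]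
  simp only [truncate, ite_pow, ne_eq, OfNat.ofNat_ne_zero, not_false_eq_true, zero_pow]
  rw [← Finset.sum_filter]
  refine Finset.sum_le_sum_of_subset_of_nonneg (fun j hj ↦ ?_) fun _ _ _ ↦ sq_nonneg _
  simpa using (Finset.mem_filter.mp hj).2

/-- Truncating a finitely supported sequence only loses chains of indices. -/
theorem exists_jamesEnergy_eq_truncate (x : ℕ → ℝ) (m n k : ℕ) {p : ℕ → ℕ} (hp : StrictMono p) :
    ∃ q : ℕ → ℕ, StrictMono q ∧
      jamesEnergy (truncate n x) k q = jamesEnergy (truncate m (truncate n x)) k p := by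
  refine ⟨fun i ↦ if p i < m then p i else p i + n, fun i j hij ↦ ?_, ?_⟩
  · have := hp hij
    dsimp only
    split_ifs <;> omega
  · have h : ∀ i, truncate n x (if p i < m then p i else p i + n) =
        truncate m (truncate n x) (p i) := by
      intro i
      by_cases hi : p i < m <;> simp [truncate, hi]
    simp only [jamesEnergy, h]

theorem bddAbove_james (n : ℕ) (x : ℕ → ℝ) :
    BddAbove {r : ℝ | ∃ (k : ℕ) (p : ℕ → ℕ), StrictMono p ∧
      r = √(jamesEnergy (truncate n x) k p)} := by
  refine ⟨√(4 * ∑ j ∈ Finset.range n, x j ^ 2), ?_⟩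
  rintro _ ⟨k, p, hp, rfl⟩
  exact Real.sqrt_le_sqrt (jamesEnergy_truncate_le_sum_sq x n k hp)

theorem jamesNorm_nonneg (x : ℕ → ℝ) : 0 ≤ jamesNorm x := by
  refine Real.sSup_nonneg ?_
  rintro _ ⟨k, p, -, rfl⟩
  positivity

theorem jamesEnergy_truncate_le (n : ℕ) (x : ℕ → ℝ) (k : ℕ) {p : ℕ → ℕ} (hp : StrictMono p) :
    jamesEnergy (truncate n x) k p ≤ jamesNorm (truncate n x) ^ 2 := by
  rw [← Real.sqrt_le_left (jamesNorm_nonneg _)]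
  exact le_csSup (bddAbove_james n x) ⟨k, p, hp, rfl⟩

theorem jamesNorm_le {x : ℕ → ℝ} {a : ℝ}
    (h : ∀ k p, StrictMono p → √(jamesEnergy x k p) ≤ a) : jamesNorm x ≤ a := by
  refine csSup_le ⟨_, 0, id, strictMono_id, rfl⟩ ?_
  rintro _ ⟨k, p, hp, rfl⟩
  exact h k p hp

/-- The sequences all of whose truncations lie in the unit ball of the James space. -/
def jamesBall : Set (ℕ → ℝ) :=
  {x | ∀ m k p, StrictMono p → jamesEnergy (truncate m x) k p ≤ 1}

theorem truncate_mem_jamesBall {x : ℕ → ℝ} (hx : x ∈ jamesBall) (n : ℕ) :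
    truncate n x ∈ jamesBall := by
  intro m k p hp
  rw [truncate_truncate]
  exact hx _ k p hp

theorem zero_mem_jamesBall : (0 : ℕ → ℝ) ∈ jamesBall := by
  intro m k p _
  simp [jamesEnergy, truncate]

theorem abs_apply_le_one {x : ℕ → ℝ} (hx : x ∈ jamesBall) (j : ℕ) : |x j| ≤ 1 := by
  have h := hx (j + 1) 0 (fun i ↦ j + i) fun a b hab ↦ by dsimp only; omega
  simpa [jamesEnergy, truncate, sq_le_one_iff_abs_le_one] using h

theorem inv_smul_truncate_mem_jamesBall {n : ℕ} {x : ℕ → ℝ} (h : 0 < jamesNorm (truncate n x)) :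
    (jamesNorm (truncate n x))⁻¹ • truncate n x ∈ jamesBall := by
  intro m k p hp
  obtain ⟨q, hq, hqp⟩ := exists_jamesEnergy_eq_truncate x m n k hp
  rw [truncate_smul, jamesEnergy_smul, ← hqp, inv_pow, inv_mul_le_iff₀ (by positivity), mul_one]
  exact jamesEnergy_truncate_le n x k hq

/-- The dual James norm of the first `n` coordinates of `y`. -/
noncomputable def jamesDual (n : ℕ) (y : ℕ → ℝ) : ℝ :=
  sSup ((fun x : ℕ → ℝ ↦ |∑ j ∈ Finset.range n, y j * x j|) '' jamesBall)

theorem jamesDual_le {n : ℕ} {y : ℕ → ℝ} {a : ℝ}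
    (h : ∀ x ∈ jamesBall, |∑ j ∈ Finset.range n, y j * x j| ≤ a) : jamesDual n y ≤ a := by
  refine csSup_le (Set.Nonempty.image _ ⟨0, zero_mem_jamesBall⟩) ?_
  rintro _ ⟨x, hx, rfl⟩
  exact h x hx

theorem abs_sum_le_sum_abs {x : ℕ → ℝ} (hx : x ∈ jamesBall) (n : ℕ) (y : ℕ → ℝ) :
    |∑ j ∈ Finset.range n, y j * x j| ≤ ∑ j ∈ Finset.range n, |y j| := by
  refine (Finset.abs_sum_le_sum_abs _ _).trans (Finset.sum_le_sum fun j _ ↦ ?_)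
  rw [abs_mul]
  exact mul_le_of_le_one_right (abs_nonneg _) (abs_apply_le_one hx j)

theorem abs_sum_le_jamesDual {x : ℕ → ℝ} (hx : x ∈ jamesBall) (n : ℕ) (y : ℕ → ℝ) :
    |∑ j ∈ Finset.range n, y j * x j| ≤ jamesDual n y := by
  refine le_csSup ⟨∑ j ∈ Finset.range n, |y j|, ?_⟩ ⟨x, hx, rfl⟩
  rintro _ ⟨z, hz, rfl⟩
  exact abs_sum_le_sum_abs hz n y

theorem monotone_jamesDual (y : ℕ → ℝ) : Monotone fun n ↦ jamesDual n y := by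
  intro m n hmn
  refine jamesDual_le fun x hx ↦ ?_
  have h : ∑ j ∈ Finset.range m, y j * x j = ∑ j ∈ Finset.range n, y j * truncate m x j := by
    simp only [truncate, mul_ite, mul_zero]
    rw [← Finset.sum_filter]
    refine Finset.sum_congr ?_ fun _ _ ↦ rfl
    ext j
    simp only [Finset.mem_range, Finset.mem_filter]
    omega
  rw [h]
  exact abs_sum_le_jamesDual (truncate_mem_jamesBall hx m) n y

theorem jamesDual_le_add (n : ℕ) (y z : ℕ → ℝ) :
    jamesDual n y ≤ jamesDual n z + ∑ j ∈ Finset.range n, |y j - z j| := by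
  refine jamesDual_le fun x hx ↦ ?_
  have h : ∑ j ∈ Finset.range n, y j * x j =
      ∑ j ∈ Finset.range n, z j * x j + ∑ j ∈ Finset.range n, (y j - z j) * x j := by
    rw [← Finset.sum_add_distrib]
    exact Finset.sum_congr rfl fun j _ ↦ by ring
  rw [h]
  exact (abs_add_le _ _).trans (add_le_add (abs_sum_le_jamesDual hx n z)
    (abs_sum_le_sum_abs hx n fun j ↦ y j - z j))

theorem continuous_jamesDual (n : ℕ) : Continuous (jamesDual n) := by
  refine continuous_iff_continuousAt.mpr fun z ↦ ?_
  have hlim : Filter.Tendsto (fun y : ℕ → ℝ ↦ ∑ j ∈ Finset.range n, |y j - z j|)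
      (nhds z) (nhds 0) := by
    have : Continuous fun y : ℕ → ℝ ↦ ∑ j ∈ Finset.range n, |y j - z j| := by fun_prop
    simpa using this.tendsto z
  refine tendsto_iff_dist_tendsto_zero.mpr (squeeze_zero (fun _ ↦ dist_nonneg) (fun y ↦ ?_) hlim)
  rw [Real.dist_eq, abs_sub_le_iff]
  have h₁ := jamesDual_le_add n y z
  have h₂ := jamesDual_le_add n z y
  simp only [abs_sub_comm (z _)] at h₂
  constructor <;> linarith

/-- The cutoff factors `min 1 (max 0 (2 - jamesDual (n + 1) y))`. -/
noncomputable def jamesCutoff (n : ℕ) (y : ℕ → ℝ) : ℝ :=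
  min 1 (max 0 (2 - jamesDual (n + 1) y))

theorem continuous_jamesCutoff (n : ℕ) : Continuous (jamesCutoff n) := by
  have := continuous_jamesDual (n + 1)
  unfold jamesCutoff
  fun_prop

theorem jamesCutoff_nonneg (n : ℕ) (y : ℕ → ℝ) : 0 ≤ jamesCutoff n y :=
  le_min zero_le_one (le_max_left _ _)

theorem jamesCutoff_succ_le (n : ℕ) (y : ℕ → ℝ) : jamesCutoff (n + 1) y ≤ jamesCutoff n y := by
  have := monotone_jamesDual y (Nat.le_succ (n + 1))
  exact min_le_min_left _ (max_le_max_left _ (sub_le_sub_left this _))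

theorem jamesCutoff_mul_jamesDual_le (n : ℕ) (y : ℕ → ℝ) {t : ℝ} (ht : 0 ≤ t)
    (htn : t ≤ jamesCutoff n y) : t * jamesDual (n + 1) y ≤ 2 * t := by
  rcases le_total (jamesDual (n + 1) y) 2 with h | h
  · nlinarith
  · have : jamesCutoff n y = 0 := by simp [jamesCutoff, max_eq_left (sub_nonpos.mpr h)]
    have : t = 0 := by linarith
    simp [this]

/-- Cutting off maps every sequence into twice the dual ball. -/
theorem abs_sum_jamesCutoff_le {x : ℕ → ℝ} (hx : x ∈ jamesBall) (n : ℕ) (y : ℕ → ℝ) :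
    |∑ j ∈ Finset.range n, jamesCutoff j y * y j * x j| ≤ 2 := by
  set S : ℕ → ℝ := fun m ↦ ∑ j ∈ Finset.range m, y j * x j
  set T : ℕ → ℝ := fun m ↦ ∑ j ∈ Finset.range m, jamesCutoff j y * y j * x j
  have hmul : ∀ m t, 0 ≤ t → t ≤ jamesCutoff m y → |t * S (m + 1)| ≤ 2 * t := fun m t h₀ h₁ ↦ by
    rw [abs_mul, abs_of_nonneg h₀]
    exact (mul_le_mul_of_nonneg_left (abs_sum_le_jamesDual hx (m + 1) y) h₀).trans
      (jamesCutoff_mul_jamesDual_le m y h₀ h₁)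
  have hSs : ∀ m, S (m + 1) = S m + y m * x m := fun m ↦ Finset.sum_range_succ _ m
  have hTs : ∀ m, T (m + 1) = T m + jamesCutoff m y * y m * x m :=
    fun m ↦ Finset.sum_range_succ _ m
  have hmain : ∀ m, |T m - jamesCutoff m y * S m| ≤ 2 * (jamesCutoff 0 y - jamesCutoff m y) := by
    intro m
    induction m with
    | zero => simp [S, T]
    | succ m ih =>
      have h := hmul m (jamesCutoff m y - jamesCutoff (m + 1) y)
        (sub_nonneg.mpr (jamesCutoff_succ_le m y))
        (sub_le_self _ (jamesCutoff_nonneg _ _))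
      have e : T (m + 1) - jamesCutoff (m + 1) y * S (m + 1) =
          (T m - jamesCutoff m y * S m) +
            (jamesCutoff m y - jamesCutoff (m + 1) y) * S (m + 1) := by
        rw [hTs, hSs]; ring
      rw [e]
      refine (abs_add_le _ _).trans ?_
      linarith
  change |T n| ≤ 2
  cases n with
  | zero => simp [T]
  | succ m =>
    have e : T (m + 1) = (T m - jamesCutoff m y * S m) + jamesCutoff m y * S (m + 1) := by
      rw [hTs, hSs]; ring
    have h := hmul m _ (jamesCutoff_nonneg m y) le_rfl
    have h₀ : jamesCutoff 0 y ≤ 1 := min_le_left _ _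
    rw [e]
    refine (abs_add_le _ _).trans ?_
    linarith [hmain m]

theorem abs_sum_jamesCutoff_le_jamesNorm (n : ℕ) (x y : ℕ → ℝ) :
    |∑ j ∈ Finset.range n, jamesCutoff j y * y j * x j| ≤ 2 * jamesNorm (truncate n x) := by
  rcases (jamesNorm_nonneg (truncate n x)).eq_or_lt with h | h
  · have hz : ∀ j ∈ Finset.range n, x j = 0 := fun j hj ↦ by
      have hE := jamesEnergy_truncate_le n x 0 (p := fun i ↦ j + i)
        fun a b hab ↦ by dsimp only; omega
      rw [← h] at hE
      simpa [jamesEnergy, truncate, Finset.mem_range.mp hj] using hE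
    rw [← h, Finset.sum_eq_zero fun j hj ↦ by rw [hz j hj, mul_zero]]
    simp
  · have hb := abs_sum_jamesCutoff_le (inv_smul_truncate_mem_jamesBall h) n y
    set N := jamesNorm (truncate n x)
    have e : ∑ j ∈ Finset.range n, jamesCutoff j y * y j * (N⁻¹ • truncate n x) j =
        N⁻¹ * ∑ j ∈ Finset.range n, jamesCutoff j y * y j * x j := by
      rw [Finset.mul_sum]
      refine Finset.sum_congr rfl fun j hj ↦ ?_
      simp only [truncate, Pi.smul_apply, smul_eq_mul, if_pos (Finset.mem_range.mp hj)]
      ring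
    rw [e, abs_mul, abs_of_pos (inv_pos.mpr h), inv_mul_le_iff₀ h] at hb
    linarith

/-- The bilinear form polarizing `jamesEnergy`, as a functional in the second variable. -/
def jamesFunctional (x : ℕ → ℝ) (k : ℕ) (p : ℕ → ℕ) : (ℕ → ℝ) →ₗ[ℝ] ℝ :=
  x (p 0) • (LinearMap.proj (p 0) : (ℕ → ℝ) →ₗ[ℝ] ℝ) + ∑ i ∈ Finset.range k,
    (x (p (i + 1)) - x (p i)) •
      ((LinearMap.proj (p (i + 1)) : (ℕ → ℝ) →ₗ[ℝ] ℝ) - LinearMap.proj (p i))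

theorem jamesFunctional_apply (x z : ℕ → ℝ) (k : ℕ) (p : ℕ → ℕ) :
    jamesFunctional x k p z = x (p 0) * z (p 0) + ∑ i ∈ Finset.range k,
      (x (p (i + 1)) - x (p i)) * (z (p (i + 1)) - z (p i)) := by
  simp [jamesFunctional]

theorem jamesFunctional_self (x : ℕ → ℝ) (k : ℕ) (p : ℕ → ℕ) :
    jamesFunctional x k p x = jamesEnergy x k p := by
  simp [jamesFunctional_apply, jamesEnergy, sq]

theorem jamesFunctional_sq_le (x z : ℕ → ℝ) (k : ℕ) (p : ℕ → ℕ) :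
    jamesFunctional x k p z ^ 2 ≤ jamesEnergy x k p * jamesEnergy z k p := by
  rw [jamesFunctional_apply]
  have h := Finset.sum_mul_sq_le_sq_mul_sq (Finset.range (k + 1))
    (fun | 0 => x (p 0) | i + 1 => x (p (i + 1)) - x (p i))
    (fun | 0 => z (p 0) | i + 1 => z (p (i + 1)) - z (p i))
  simp only [Finset.sum_range_succ'] at h
  simpa only [jamesEnergy, add_comm] using h

/-- Every James sum is attained by a functional in the dual unit ball. -/
theorem exists_dual_eq_sqrt_jamesEnergy (n : ℕ) (x : ℕ → ℝ) (k : ℕ) {p : ℕ → ℕ}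
    (hp : StrictMono p) : ∃ y ∈ Set.Icc (-2 : ℕ → ℝ) 2, (∀ m, jamesDual m y ≤ 1) ∧
      ∑ j ∈ Finset.range n, y j * x j = √(jamesEnergy (truncate n x) k p) := by
  set E := jamesEnergy (truncate n x) k p with hE
  let L := (√E)⁻¹ • jamesFunctional (truncate n x) k p
  have hE₀ : 0 ≤ E := jamesEnergy_nonneg _ _ _
  have hL : ∀ z, L z ^ 2 ≤ jamesEnergy z k p := fun z ↦ by
    simp only [L, LinearMap.smul_apply, smul_eq_mul, mul_pow, inv_pow, Real.sq_sqrt hE₀]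
    rcases hE₀.eq_or_lt with h | h
    · simpa [← h] using jamesEnergy_nonneg z k p
    · rw [inv_mul_le_iff₀ h]
      exact jamesFunctional_sq_le _ _ _ _
  refine ⟨fun j ↦ L (Pi.single j 1), ?_, fun m ↦ jamesDual_le fun z hz ↦ ?_, ?_⟩
  · have h : ∀ j, |L (Pi.single j 1)| ≤ 2 := fun j ↦ by
      refine abs_le_of_sq_le_sq ?_ zero_le_two
      refine (hL _).trans ?_
      have e : truncate (j + 1) (Pi.single j 1) = Pi.single j 1 := by
        ext i
        by_cases hi : i = j <;> simp [truncate, hi]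
      have := jamesEnergy_truncate_le_sum_sq (Pi.single j 1) (j + 1) k hp
      rw [e] at this
      refine this.trans (le_of_eq ?_)
      simp [Pi.single_apply]
      norm_num
    exact ⟨fun j ↦ (abs_le.mp (h j)).1, fun j ↦ (abs_le.mp (h j)).2⟩
  · rw [← map_truncate, ← sq_le_one_iff_abs_le_one]
    exact (hL _).trans (hz m k p hp)
  · rw [← map_truncate]
    simp only [L, LinearMap.smul_apply, smul_eq_mul, jamesFunctional_self, ← hE]
    rcases hE₀.eq_or_lt with h | h
    · simp [← h]
    · rw [inv_mul_eq_div, Real.div_sqrt]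

/-- There exist a constant `M > 0` and a sequence `(f_n)_{n ≥ 1}` of continuous real-valued
functions on `[0,1]` such that for every `n` and all reals `λ_1, …, λ_n`,
`(1/M)·‖(λ_1, …, λ_n, 0, …)‖_J ≤ ‖λ_1 f_1 + ⋯ + λ_n f_n‖_∞ ≤ M·‖(λ_1, …, λ_n, 0, …)‖_J`,
where `‖·‖_∞` is the supremum norm on `C[0,1]`.  (The sequence `(λ_1, …, λ_n, 0, …)`
is encoded `0`-based as `fun j => if j < n then lam (j + 1) else 0`.) -/
theorem exists_james_sequence_in_C01 :
    ∃ M : ℝ, 0 < M ∧ ∃ f : ℕ → C(I, ℝ),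
      ∀ (n : ℕ) (lam : ℕ → ℝ),
        (1 / M) * jamesNorm (fun j => if j < n then lam (j + 1) else 0) ≤
          ‖∑ i ∈ Finset.Icc 1 n, lam i • f i‖ ∧
        ‖∑ i ∈ Finset.Icc 1 n, lam i • f i‖ ≤
          M * jamesNorm (fun j => if j < n then lam (j + 1) else 0) := by
  obtain ⟨φ, hφ⟩ := (isCompact_Icc (a := (-2 : ℕ → ℝ)) (b := 2)).exists_path_range_superset
    ⟨0, fun _ ↦ by simp, fun _ ↦ by simp⟩
  let f : ℕ → C(I, ℝ) := fun i ↦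
    ⟨fun t ↦ jamesCutoff (i - 1) (φ t) * φ t (i - 1),
      ((continuous_jamesCutoff _).comp φ.continuous).mul
        ((continuous_apply _).comp φ.continuous)⟩
  refine ⟨2, two_pos, f, fun n lam ↦ ?_⟩
  set x : ℕ → ℝ := fun j ↦ lam (j + 1)
  change 1 / 2 * jamesNorm (truncate n x) ≤ _ ∧ _ ≤ 2 * jamesNorm (truncate n x)
  have hf : ∀ t, (∑ i ∈ Finset.Icc 1 n, lam i • f i) t =
      ∑ j ∈ Finset.range n, jamesCutoff j (φ t) * φ t j * x j := fun t ↦ by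
    rw [← Finset.Ico_add_one_right_eq_Icc, Finset.sum_Ico_eq_sum_range]
    simp [f, x, mul_comm, add_comm 1]
  constructor
  · have h : jamesNorm (truncate n x) ≤ ‖∑ i ∈ Finset.Icc 1 n, lam i • f i‖ := by
      refine jamesNorm_le fun k p hp ↦ ?_
      obtain ⟨y, hy, hdual, hyx⟩ := exists_dual_eq_sqrt_jamesEnergy n x k hp
      obtain ⟨t, ht⟩ := hφ hy
      have hcut : ∀ j, jamesCutoff j y = 1 := fun j ↦
        min_eq_left (le_max_of_le_right (by linarith [hdual (j + 1)]))
      have := (le_abs_self _).trans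
        (ContinuousMap.norm_coe_le_norm (∑ i ∈ Finset.Icc 1 n, lam i • f i) t)
      simpa only [hf, ht, hcut, one_mul, hyx] using this
    linarith [jamesNorm_nonneg (truncate n x)]
  · refine (ContinuousMap.norm_le _ (by linarith [jamesNorm_nonneg (truncate n x)])).mpr fun t ↦ ?_
    rw [hf, Real.norm_eq_abs]
    exact abs_sum_jamesCutoff_le_jamesNorm n x (φ t)
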